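/- Let M ≥ 2, let A = (A_1,…,A_M) be an irreducible tuple of d_1×d_1 real matrices and B = (B_1,…,B_M) an irreducible tuple of d_2×d_2 real matrices, let s, t > 0, and suppose P(A,s) > −∞ and P(B,t) > −∞. Suppose that e^{−nP(A,s)} ρ(A_{i_n}⋯A_{i_1})^s = e^{−nP(B,t)} ρ(B_{i_n}⋯B_{i_1})^t for every n ≥ 1 and all i_1,…,i_n ∈ {1,…,M}. Then for every ergodic σ-invariant Borel probability measure ν on Σ_M, for ν-almost every x ∈ Σ_M the limits ℓ_A(x) := lim_{n→∞} ‖A_{x_n}⋯A_{x_1}‖^{1/n} and ℓ_B(x) := lim_{n→∞} ‖B_{x_n}⋯B_{x_1}‖^{1/n} exist in [0,∞) and satisfy ℓ_A(x)^s = e^{P(A,s)−P(B,t)} ℓ_B(x)^t. -/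

import Mathlib

open MeasureTheory Filter Topology

/-- The operator norm on square real matrices induced by the Euclidean norm. -/
noncomputable def opNorm {n : Type*} [Fintype n] [DecidableEq n]
    (X : Matrix n n ℝ) : ℝ :=
  ‖Matrix.toEuclideanCLM (𝕜 := ℝ) X‖

/-- The spectral radius `ρ(X) = inf_{k ≥ 1} ‖X^k‖^(1/k)` (Gelfand). -/
noncomputable def specRad {n : Type*} [Fintype n] [DecidableEq n]
    (X : Matrix n n ℝ) : ℝ :=
  ⨅ k : ℕ, opNorm (X ^ (k + 1)) ^ ((1 : ℝ) / (k + 1))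

/-- The product `A_{x_n} ⋯ A_{x_1}` associated to the word `x = (x_1, …, x_n)`. -/
noncomputable def wordProd {M d n : ℕ} (A : Fin M → Matrix (Fin d) (Fin d) ℝ)
    (x : Fin n → Fin M) : Matrix (Fin d) (Fin d) ℝ :=
  (List.ofFn (fun i => A (x i))).reverse.prod

/-- The product `A_{x_n} ⋯ A_{x_1}` associated to the word `w = [x_1, …, x_n]`. -/
noncomputable def listProd {M d : ℕ} (A : Fin M → Matrix (Fin d) (Fin d) ℝ)
    (w : List (Fin M)) : Matrix (Fin d) (Fin d) ℝ :=
  ((w.map A).reverse).prod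

/-- Irreducibility: no invariant subspace `U` with `0 < dim U < d`. -/
def IsIrredTuple {M d : ℕ} (A : Fin M → Matrix (Fin d) (Fin d) ℝ) : Prop :=
  ¬ ∃ U : Submodule ℝ (Fin d → ℝ),
      (∀ i, U.map (A i).mulVecLin ≤ U) ∧ U ≠ ⊥ ∧ U ≠ ⊤

/-- The shift map on `Σ_M = {1,…,M}^ℕ`. -/
def shift {M : ℕ} : (ℕ → Fin M) → (ℕ → Fin M) := fun x n => x (n + 1)

/-- The cylinder set `[x_1 ⋯ x_n]` determined by the word `w = [x_1, …, x_n]`. -/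
def cyl {M : ℕ} (w : List (Fin M)) : Set (ℕ → Fin M) :=
  {y | ∀ i : Fin w.length, y (i : ℕ) = w.get i}

/-- The Gibbs inequality for `(A, s)` with constants `C > 0`, `P ∈ ℝ`. -/
def IsGibbs {M d : ℕ} (A : Fin M → Matrix (Fin d) (Fin d) ℝ) (s C P : ℝ)
    (μ : Measure (ℕ → Fin M)) : Prop :=
  ∀ w : List (Fin M), w ≠ [] →
    C⁻¹ * (μ (cyl w)).toReal ≤ Real.exp (-(w.length : ℝ) * P) * opNorm (listProd A w) ^ s ∧
    Real.exp (-(w.length : ℝ) * P) * opNorm (listProd A w) ^ s ≤ C * (μ (cyl w)).toReal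

/-- The pressure `P(A,s) = inf_{n ≥ 1} (1/n) log Σ_{|x| = n} ‖A_{x_n} ⋯ A_{x_1}‖^s ∈ [-∞, ∞)`,
with the convention that a term is `-∞` when the corresponding sum vanishes. -/
noncomputable def pressure {M d : ℕ} (A : Fin M → Matrix (Fin d) (Fin d) ℝ) (s : ℝ) : EReal :=
  ⨅ n : ℕ,
    if (∑ x : Fin (n + 1) → Fin M, opNorm (wordProd A x) ^ s) = 0 then (⊥ : EReal)
    else ((Real.log (∑ x : Fin (n + 1) → Fin M, opNorm (wordProd A x) ^ s) / (n + 1) : ℝ) : EReal)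


section Erg
set_option linter.unusedSectionVars false
variable {X : Type*} [MeasurableSpace X] {μ : Measure X} [IsProbabilityMeasure μ] {T : X → X}

/-- Number of visits to `E` before time `n`. -/
noncomputable def vis (T : X → X) (E : Set X) (n : ℕ) (x : X) : ℝ :=
  birkhoffSum T (E.indicator (fun _ => (1 : ℝ))) n x

lemma vis_nonneg (T : X → X) (E : Set X) (n : ℕ) (x : X) : 0 ≤ vis T E n x := by
  unfold vis birkhoffSum
  exact Finset.sum_nonneg fun _ _ => Set.indicator_nonneg (fun _ _ => zero_le_one) _

lemma vis_le (T : X → X) (E : Set X) (n : ℕ) (x : X) : vis T E n x ≤ n := by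
  unfold vis birkhoffSum
  calc _ ≤ ∑ k ∈ Finset.range n, (1 : ℝ) := Finset.sum_le_sum fun k _ =>
        Set.indicator_le_self' (fun _ _ => zero_le_one) _
    _ = n := by simp

lemma vis_add (T : X → X) (E : Set X) (m n : ℕ) (x : X) :
    vis T E (m + n) x = vis T E m x + vis T E n (T^[m] x) := birkhoffSum_add _ _ _ _ _

lemma vis_one (T : X → X) (E : Set X) (x : X) :
    vis T E 1 x = E.indicator (fun _ => (1 : ℝ)) x := birkhoffSum_one _ _ _

lemma vis_measurable (hT : Measurable T) {E : Set X} (hE : MeasurableSet E) (n : ℕ) :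
    Measurable (vis T E n) := by
  unfold vis birkhoffSum
  apply Finset.measurable_sum
  intro k _
  exact (measurable_const.indicator hE).comp (hT.iterate k)

lemma vis_integrable (hT : Measurable T) {E : Set X} (hE : MeasurableSet E) (n : ℕ) :
    Integrable (vis T E n) μ := by
  refine Integrable.of_bound (vis_measurable hT hE n).aestronglyMeasurable n (ae_of_all _ fun x => ?_)
  rw [Real.norm_of_nonneg (vis_nonneg _ _ _ _)]
  exact vis_le _ _ _ _

lemma vis_integral (hT : MeasurePreserving T μ μ) {E : Set X} (hE : MeasurableSet E) (n : ℕ) :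
    ∫ x, vis T E n x ∂μ = n * μ.real E := by
  induction n with
  | zero => simp [vis]
  | succ n ih =>
    have : vis T E (n+1) = fun x => vis T E n x + (T^[n] ⁻¹' E).indicator (fun _ => (1 : ℝ)) x := by
      ext x
      rw [vis_add, vis_one]; rfl
    rw [this, integral_add (vis_integrable hT.measurable hE n), ih]
    · have h2 := hT.iterate n
      rw [integral_indicator (h2.measurable hE)]
      simp [measureReal_def, h2.measure_preimage hE.nullMeasurableSet]
      ring
    · exact (integrable_const 1).indicator ((hT.measurable.iterate n) hE)

lemma vis_cover (T : X → X) (E : Set X) (l : ℝ) (hl : 0 ≤ l) (N : ℕ) (n : ℕ) :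
    ∀ x, l * vis T {x | ∃ m, 1 ≤ m ∧ m ≤ N ∧ l * m ≤ vis T E m x} n x ≤ vis T E n x + l * N := by
  induction n using Nat.strong_induction_on with
  | _ n ih =>
  intro x
  set G := {x | ∃ m, 1 ≤ m ∧ m ≤ N ∧ l * m ≤ vis T E m x} with hG
  rcases le_or_gt n N with hn | hn
  · have h1 := vis_le T G n x
    have h2 := vis_nonneg T E n x
    have h3 : (n : ℝ) ≤ N := by exact_mod_cast hn
    have := mul_le_mul_of_nonneg_left (h1.trans h3) hl
    linarith
  · by_cases hx : x ∈ G
    · obtain ⟨m, hm1, hmN, hm⟩ := hx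
      obtain ⟨k, rfl⟩ := Nat.exists_eq_add_of_le (hmN.trans hn.le)
      have := ih k (by omega) (T^[m] x)
      rw [vis_add, vis_add]
      have h1 := mul_le_mul_of_nonneg_left (vis_le T G m x) hl
      linarith
    · obtain ⟨k, rfl⟩ := Nat.exists_eq_add_of_le (show 1 ≤ n by omega)
      have := ih k (by omega) (T^[1] x)
      rw [vis_add, vis_add, vis_one T G, Set.indicator_of_notMem hx]
      have h1 := vis_nonneg T E 1 x
      linarith

lemma maximal_N (hT : MeasurePreserving T μ μ) {E : Set X} (hE : MeasurableSet E)
    (l : ℝ) (hl : 0 ≤ l) (N : ℕ) :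
    l * μ.real {x | ∃ m, 1 ≤ m ∧ m ≤ N ∧ l * m ≤ vis T E m x} ≤ μ.real E := by
  set G := {x | ∃ m, 1 ≤ m ∧ m ≤ N ∧ l * m ≤ vis T E m x} with hG
  have hGm : MeasurableSet G := by
    have : G = ⋃ m : ℕ, ⋃ (_ : 1 ≤ m ∧ m ≤ N), {x | l * m ≤ vis T E m x} := by
      ext x; simp [hG, and_assoc]
    rw [this]
    exact MeasurableSet.iUnion fun m => MeasurableSet.iUnion fun _ =>
      measurableSet_le measurable_const (vis_measurable hT.measurable hE m)
  have key : ∀ n : ℕ, (n : ℝ) * (l * μ.real G - μ.real E) ≤ l * N := by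
    intro n
    have h1 : ∫ x, l * vis T G n x ∂μ ≤ ∫ x, (vis T E n x + l * N) ∂μ := by
      apply integral_mono
      · exact (vis_integrable hT.measurable hGm n).const_mul l
      · exact (vis_integrable hT.measurable hE n).add (integrable_const _)
      · exact fun x => vis_cover T E l hl N n x
    rw [integral_const_mul, integral_add (vis_integrable hT.measurable hE n) (integrable_const _),
      vis_integral hT hGm, vis_integral hT hE] at h1
    simp at h1
    nlinarith
  by_contra! hc
  have hp : 0 < l * μ.real G - μ.real E := by linarith
  obtain ⟨n, hn⟩ := exists_nat_gt (l * N / (l * μ.real G - μ.real E))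
  rw [div_lt_iff₀ hp] at hn
  linarith [key n]

/-- Maximal inequality -/
lemma maximal (hT : MeasurePreserving T μ μ) {E : Set X} (hE : MeasurableSet E)
    (l : ℝ) (hl : 0 < l) :
    μ.real {x | ∃ m : ℕ, 1 ≤ m ∧ l * m ≤ vis T E m x} ≤ μ.real E / l := by
  have hU : {x | ∃ m : ℕ, 1 ≤ m ∧ l * m ≤ vis T E m x} =
      ⋃ N : ℕ, {x | ∃ m, 1 ≤ m ∧ m ≤ N ∧ l * m ≤ vis T E m x} := by
    ext x; simp only [Set.mem_ofPred_eq, Set.mem_iUnion]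
    constructor
    · rintro ⟨m, h1, h2⟩; exact ⟨m, m, h1, le_rfl, h2⟩
    · rintro ⟨_, m, h1, _, h2⟩; exact ⟨m, h1, h2⟩
  have hmono : Monotone fun N : ℕ => {x | ∃ m : ℕ, 1 ≤ m ∧ m ≤ N ∧ l * m ≤ vis T E m x} := by
    rintro a b hab x ⟨m, h1, h2, h3⟩
    exact ⟨m, h1, h2.trans hab, h3⟩
  have ht := tendsto_measure_iUnion_atTop (μ := μ) hmono
  rw [← hU] at ht
  have ht' := (ENNReal.tendsto_toReal (measure_ne_top _ _)).comp ht
  refine le_of_tendsto ht' (Eventually.of_forall fun N => ?_)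
  rw [le_div_iff₀ hl, mul_comm]
  exact maximal_N hT hE l hl.le N

lemma sub_cover (T : X → X) (b : ℕ → X → ℝ) (hb0 : ∀ n x, 0 ≤ b n x) (hb1 : ∀ n x, b n x ≤ 1)
    (hsub : ∀ m n x, b (m + n) x ≤ b m x * b n (T^[m] x)) (q : ℝ) (hq0 : 0 < q) (hq1 : q ≤ 1)
    (N n : ℕ) : ∀ x, b n x * q ^ ((N : ℝ) + vis T {x | ∀ m, 1 ≤ m → m ≤ N → q ^ m < b m x} n x)
      ≤ q ^ (n : ℝ) := by
  induction n using Nat.strong_induction_on with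
  | _ n ih =>
  intro x
  set E := {x | ∀ m, 1 ≤ m → m ≤ N → q ^ m < b m x} with hE
  rcases le_or_gt n N with hn | hn
  · have h3 : (n : ℝ) ≤ N := by exact_mod_cast hn
    calc _ ≤ 1 * q ^ ((N : ℝ) + vis T E n x) := by
          gcongr; exact hb1 n x
      _ ≤ q ^ (n : ℝ) := by
          rw [one_mul]
          exact Real.rpow_le_rpow_of_exponent_ge hq0 hq1 (by linarith [vis_nonneg T E n x])
  · by_cases hx : x ∈ E
    · obtain ⟨k, rfl⟩ := Nat.exists_eq_add_of_le (show 1 ≤ n by omega)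
      have := ih k (by omega) (T^[1] x)
      rw [vis_add, vis_one T E, Set.indicator_of_mem hx]
      have e : (N : ℝ) + (1 + vis T E k (T^[1] x)) = ((N : ℝ) + vis T E k (T^[1] x)) + 1 := by ring
      rw [e, Real.rpow_add hq0 _ 1]
      push_cast
      rw [add_comm (1 : ℝ), Real.rpow_add hq0 (k : ℝ) 1, Real.rpow_one, ← mul_assoc]
      refine mul_le_mul_of_nonneg_right ?_ hq0.le
      refine le_trans ?_ this
      refine mul_le_mul_of_nonneg_right ?_ (by positivity)
      refine (hsub 1 k x).trans ?_
      exact mul_le_of_le_one_left (hb0 _ _) (hb1 _ _)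
    · simp only [hE, Set.mem_ofPred_eq, not_forall, not_lt] at hx
      obtain ⟨m, hm1, hmN, hm⟩ := hx
      obtain ⟨k, rfl⟩ := Nat.exists_eq_add_of_le (hmN.trans hn.le)
      have := ih k (by omega) (T^[m] x)
      rw [vis_add]
      push_cast
      rw [Real.rpow_add hq0 (m : ℝ), Real.rpow_natCast q m]
      calc _ ≤ (q ^ m * b k (T^[m] x)) * q ^ ((N : ℝ) + vis T E k (T^[m] x)) := by
            apply mul_le_mul
            · refine (hsub m k x).trans ?_
              gcongr
              exact hb0 _ _
            · exact Real.rpow_le_rpow_of_exponent_ge hq0 hq1 (by linarith [vis_nonneg T E m x])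
            · positivity
            · exact mul_nonneg (by positivity) (hb0 _ _)
        _ ≤ _ := by
          rw [mul_assoc]; gcongr

lemma upper (hT : MeasurePreserving T μ μ) (b : ℕ → X → ℝ) (hbm : ∀ n, Measurable (b n))
    (hb0 : ∀ n x, 0 ≤ b n x) (hb1 : ∀ n x, b n x ≤ 1)
    (hsub : ∀ m n x, b (m + n) x ≤ b m x * b n (T^[m] x)) (q : ℝ) (hq0 : 0 < q) (hq1 : q ≤ 1)
    (hq : ∀ᵐ x ∂μ, ∃ n, 1 ≤ n ∧ b n x ≤ q ^ n) (r : ℝ) (hr : q < r) :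
    ∀ᵐ x ∂μ, ∀ᶠ n in atTop, b n x ≤ r ^ n := by
  let E : ℕ → Set X := fun N => {x | ∀ m, 1 ≤ m → m ≤ N → q ^ m < b m x}
  have hEm : ∀ N, MeasurableSet (E N) := by
    intro N
    have : E N = ⋂ m : ℕ, ⋂ (_ : 1 ≤ m), ⋂ (_ : m ≤ N), {x | q ^ m < b m x} := by
      ext x; simp [E]
    rw [this]
    exact MeasurableSet.iInter fun m => MeasurableSet.iInter fun _ => MeasurableSet.iInter fun _ =>
      measurableSet_lt measurable_const (hbm m)
  have hE0 : Tendsto (fun N => μ.real (E N)) atTop (𝓝 0) := by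
    have hanti : Antitone E := fun a c hac x hx m h1 h2 => hx m h1 (h2.trans hac)
    have h1 := tendsto_measure_iInter_atTop (μ := μ) (fun N => (hEm N).nullMeasurableSet) hanti
      ⟨0, measure_ne_top _ _⟩
    have h2 : μ (⋂ N, E N) = 0 := by
      refine measure_mono_null ?_ hq
      intro x hx
      simp only [Set.mem_iInter] at hx
      rintro ⟨n, h1, h2⟩
      exact absurd h2 (not_le.2 (hx n n h1 le_rfl))
    rw [h2] at h1
    exact (ENNReal.tendsto_toReal ENNReal.zero_ne_top).comp h1
  have hl : ∃ l0 : ℝ, 0 < l0 ∧ ∀ l, 0 < l → l ≤ l0 → q ^ (1 - l) < r := by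
    have hc : Tendsto (fun l : ℝ => q ^ (1 - l)) (𝓝 0) (𝓝 (q ^ (1 - (0:ℝ)))) := by
      have h1 : Continuous fun l : ℝ => q ^ (1 - l) :=
        Continuous.rpow (by fun_prop) (by fun_prop) (fun _ => Or.inl hq0.ne')
      exact h1.tendsto 0
    rw [sub_zero, Real.rpow_one] at hc
    have := hc.eventually (gt_mem_nhds hr)
    obtain ⟨ε, hε, h⟩ := Metric.eventually_nhds_iff.1 this
    refine ⟨ε / 2, by positivity, fun l hl hl' => h ?_⟩
    rw [Real.dist_eq, sub_zero, abs_of_pos hl]; linarith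
  obtain ⟨l0, hl0, hl⟩ := hl
  have hgood : ∀ l, 0 < l → l ≤ l0 → ∀ N, ∀ x, (¬ ∃ m : ℕ, 1 ≤ m ∧ l * m ≤ vis T (E N) m x) →
      ∀ᶠ n in atTop, b n x ≤ r ^ n := by
    intro l hlp hll N x hx
    push Not at hx
    have h1 := hl l hlp hll
    have hp : 0 < q ^ (1 - l) := Real.rpow_pos_of_pos hq0 _
    have h2 : Tendsto (fun n : ℕ => (r / q ^ (1 - l)) ^ n) atTop atTop :=
      tendsto_pow_atTop_atTop_of_one_lt ((one_lt_div hp).2 h1)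
    filter_upwards [h2.eventually_ge_atTop ((q ^ (N : ℝ))⁻¹), eventually_ge_atTop 1] with n hn hn1
    have h3 := sub_cover T b hb0 hb1 hsub q hq0 hq1 N n x
    have h4 := hx n hn1
    have h5 : q ^ ((N : ℝ) + l * n) ≤ q ^ ((N : ℝ) + vis T (E N) n x) :=
      Real.rpow_le_rpow_of_exponent_ge hq0 hq1 (by linarith)
    have h6 : b n x * q ^ ((N : ℝ) + l * n) ≤ q ^ (n : ℝ) :=
      (mul_le_mul_of_nonneg_left h5 (hb0 n x)).trans h3
    rw [← le_div_iff₀ (by positivity), ← Real.rpow_sub hq0] at h6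
    have e : (n : ℝ) - (N + l * n) = - (N:ℝ) + (1 - l) * n := by ring
    rw [e, Real.rpow_add hq0, Real.rpow_neg hq0.le, Real.rpow_mul hq0.le,
      Real.rpow_natCast (q ^ (1 - l)) n] at h6
    rw [div_pow, le_div_iff₀ (by positivity)] at hn
    exact h6.trans hn
  have hmeas : ∀ l, 0 < l → l ≤ l0 → μ.real {x | ¬ ∀ᶠ n in atTop, b n x ≤ r ^ n} ≤ 0 := by
    intro l hlp hll
    have : ∀ N, μ.real {x | ¬ ∀ᶠ n in atTop, b n x ≤ r ^ n} ≤ μ.real (E N) / l := by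
      intro N
      refine le_trans (measureReal_mono ?_) (maximal hT (hEm N) l hlp)
      intro x hx
      by_contra hc
      exact hx (hgood l hlp hll N x hc)
    refine ge_of_tendsto (x := atTop) (f := fun N => μ.real (E N) / l) ?_ (Eventually.of_forall this)
    simpa using hE0.div_const l
  have := hmeas l0 hl0 le_rfl
  have h0 := le_antisymm this measureReal_nonneg
  rw [ae_iff]
  exact (measureReal_eq_zero_iff).1 h0

lemma kingman (hT : Ergodic T μ) (b : ℕ → X → ℝ) (hbm : ∀ n, Measurable (b n))
    (hb0 : ∀ n x, 0 ≤ b n x) (hb1 : ∀ n x, b n x ≤ 1)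
    (hsub : ∀ m n x, b (m + n) x ≤ b m x * b n (T^[m] x)) :
    ∃ L : ℝ, 0 ≤ L ∧ ∀ᵐ x ∂μ,
      Tendsto (fun n : ℕ => b n x ^ ((1 : ℝ) / n)) atTop (𝓝 L) := by
  let S : ℝ → Set X := fun q => {x | ∃ C : ℕ, ∃ᶠ n in atTop, b n x ≤ C * q ^ n}
  have hSm : ∀ q, MeasurableSet (S q) := by
    intro q
    have : S q = ⋃ C : ℕ, ⋂ a : ℕ, ⋃ n : ℕ, ⋃ (_ : a ≤ n), {x | b n x ≤ C * q ^ n} := by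
      ext x; simp [S, frequently_atTop]
    rw [this]
    exact MeasurableSet.iUnion fun C => MeasurableSet.iInter fun a => MeasurableSet.iUnion fun n =>
      MeasurableSet.iUnion fun _ => measurableSet_le (hbm n) measurable_const
  have hSinv : ∀ q, 0 < q → T ⁻¹' (S q) ⊆ S q := by
    rintro q hq x ⟨C, hC⟩
    obtain ⟨D, hD⟩ := exists_nat_gt (C / q)
    refine ⟨D, ?_⟩
    rw [frequently_atTop] at hC ⊢
    intro a
    obtain ⟨n, hn, h⟩ := hC a
    refine ⟨1 + n, by omega, ?_⟩
    calc b (1 + n) x ≤ b 1 x * b n (T^[1] x) := hsub 1 n x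
      _ ≤ b n (T x) := mul_le_of_le_one_left (hb0 _ _) (hb1 _ _)
      _ ≤ C * q ^ n := h
      _ ≤ D * q ^ (1 + n) := by
        rw [div_lt_iff₀ hq] at hD
        rw [pow_add, pow_one, ← mul_assoc]
        gcongr
  have hS01 : ∀ q, 0 < q → (∀ᵐ x ∂μ, x ∉ S q) ∨ (∀ᵐ x ∂μ, x ∈ S q) := by
    intro q hq
    rcases hT.ae_empty_or_univ_of_preimage_ae_le (hSm q).nullMeasurableSet
      (LE.le.eventuallyLE (hSinv q hq)) with h | h
    · left
      exact eventuallyEq_empty.1 h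
    · right
      exact eventuallyEq_univ.1 h
  let Q : Set ℝ := {q | 0 < q ∧ ∀ᵐ x ∂μ, x ∈ S q}
  have h1Q : (1 : ℝ) ∈ Q := by
    refine ⟨one_pos, ae_of_all _ fun x => ⟨1, ?_⟩⟩
    exact Frequently.of_forall fun n => by simpa using hb1 n x
  have hbdd : BddBelow Q := ⟨0, fun q hq => hq.1.le⟩
  set L := sInf Q with hL
  have hL0 : 0 ≤ L := le_csInf ⟨1, h1Q⟩ fun q hq => hq.1.le
  have hlow : ∀ q, 0 < q → q < L → ∀ᵐ x ∂μ, ∀ᶠ n in atTop, q ^ n ≤ b n x := by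
    intro q hq hqL
    rcases hS01 q hq with h | h
    · filter_upwards [h] with x hx
      simp only [S, Set.mem_ofPred_eq, not_exists, not_frequently] at hx
      filter_upwards [hx 1] with n hn
      simp at hn
      exact hn.le
    · exact absurd (csInf_le hbdd (show q ∈ Q from ⟨hq, h⟩)) (not_le.2 hqL)
  have hup : ∀ r, L < r → ∀ᵐ x ∂μ, ∀ᶠ n in atTop, b n x ≤ r ^ n := by
    intro r hr
    rcases lt_or_ge 1 r with hr1 | hr1
    · exact ae_of_all _ fun x => Eventually.of_forall fun n =>
        (hb1 n x).trans (one_le_pow₀ hr1.le)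
    obtain ⟨q, hqQ, hqr⟩ := exists_lt_of_csInf_lt ⟨1, h1Q⟩ hr
    obtain ⟨p, hqp, hpr⟩ := exists_between hqr
    have hp0 : 0 < p := hqQ.1.trans hqp
    refine upper hT.toMeasurePreserving b hbm hb0 hb1 hsub p hp0 (hpr.le.trans hr1) ?_ r hpr
    filter_upwards [hqQ.2] with x hx
    obtain ⟨C, hC⟩ := hx
    have h2 : Tendsto (fun n : ℕ => (p / q) ^ n) atTop atTop :=
      tendsto_pow_atTop_atTop_of_one_lt ((one_lt_div hqQ.1).2 hqp)
    obtain ⟨n, h3, h4, h5⟩ := (hC.and_eventually ((h2.eventually_ge_atTop (C : ℝ)).and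
      (eventually_ge_atTop 1))).exists
    refine ⟨n, h5, h3.trans ?_⟩
    rwa [div_pow, le_div_iff₀ (pow_pos hqQ.1 n)] at h4
  refine ⟨L, hL0, ?_⟩
  have hlow' : ∀ᵐ x ∂μ, ∀ q : ℚ, 0 < (q : ℝ) → (q : ℝ) < L → ∀ᶠ n in atTop, (q : ℝ) ^ n ≤ b n x := by
    rw [ae_all_iff]; intro q
    by_cases h : 0 < (q : ℝ) ∧ (q : ℝ) < L
    · filter_upwards [hlow q h.1 h.2] with x hx _ _ using hx
    · exact ae_of_all _ fun x h1 h2 => absurd ⟨h1, h2⟩ h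
  have hup' : ∀ᵐ x ∂μ, ∀ q : ℚ, L < (q : ℝ) → ∀ᶠ n in atTop, b n x ≤ (q : ℝ) ^ n := by
    rw [ae_all_iff]; intro q
    by_cases h : L < (q : ℝ)
    · filter_upwards [hup q h] with x hx _ using hx
    · exact ae_of_all _ fun x h1 => absurd h1 h
  have root : ∀ (n : ℕ) (q : ℝ), 1 ≤ n → 0 ≤ q → (q ^ n) ^ ((1 : ℝ) / n) = q := by
    intro n q hn hq
    rw [one_div, Real.pow_rpow_inv_natCast hq (by omega)]
  filter_upwards [hlow', hup'] with x h1 h2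
  rw [tendsto_order]
  constructor
  · intro a ha
    rcases lt_or_ge a 0 with ha0 | ha0
    · exact Eventually.of_forall fun n => ha0.trans_le (Real.rpow_nonneg (hb0 n x) _)
    · obtain ⟨q, hq1, hq2⟩ := exists_rat_btwn ha
      filter_upwards [h1 q (ha0.trans_lt hq1) hq2, eventually_ge_atTop 1] with n hn hn1
      refine hq1.trans_le ?_
      rw [← root n q hn1 (ha0.trans hq1.le)]
      exact Real.rpow_le_rpow (pow_nonneg (ha0.trans hq1.le) n) hn (by positivity)
  · intro a ha
    obtain ⟨q, hq1, hq2⟩ := exists_rat_btwn ha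
    filter_upwards [h2 q hq1, eventually_ge_atTop 1] with n hn hn1
    refine lt_of_le_of_lt ?_ hq2
    rw [← root n q hn1 (hL0.trans hq1.le)]
    exact Real.rpow_le_rpow (hb0 n x) hn (by positivity)

end Erg

section Alg

lemma opNorm_nonneg {d : ℕ} (X : Matrix (Fin d) (Fin d) ℝ) : 0 ≤ opNorm X := norm_nonneg _

lemma opNorm_mul_le {d : ℕ} (X Y : Matrix (Fin d) (Fin d) ℝ) :
    opNorm (X * Y) ≤ opNorm X * opNorm Y := by
  unfold opNorm
  rw [map_mul]; exact norm_mul_le _ _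

lemma opNorm_one_le {d : ℕ} : opNorm (1 : Matrix (Fin d) (Fin d) ℝ) ≤ 1 := by
  unfold opNorm
  rw [map_one]
  exact ContinuousLinearMap.norm_id_le

lemma opNorm_pow_le {d : ℕ} (X : Matrix (Fin d) (Fin d) ℝ) (n : ℕ) :
    opNorm (X ^ n) ≤ opNorm X ^ n := by
  induction n with
  | zero => simpa using opNorm_one_le
  | succ n ih =>
    rw [pow_succ, pow_succ]
    exact (opNorm_mul_le _ _).trans (mul_le_mul_of_nonneg_right ih (opNorm_nonneg _))

lemma specRad_nonneg {d : ℕ} (X : Matrix (Fin d) (Fin d) ℝ) : 0 ≤ specRad X :=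
  Real.iInf_nonneg fun _ => Real.rpow_nonneg (opNorm_nonneg _) _

lemma specRad_le {d : ℕ} (X : Matrix (Fin d) (Fin d) ℝ) : specRad X ≤ opNorm X := by
  have : specRad X ≤ opNorm (X ^ (0 + 1)) ^ ((1 : ℝ) / ((0 : ℕ) + 1)) :=
    ciInf_le ⟨0, by rintro _ ⟨k, rfl⟩; exact Real.rpow_nonneg (opNorm_nonneg _) _⟩ 0
  simpa using this

lemma abs_mulVec_le {d : ℕ} (X : Matrix (Fin d) (Fin d) ℝ) (a : Fin d → ℝ) (i : Fin d) :
    |(X.mulVec a) i| ≤ opNorm X * ‖WithLp.toLp 2 a‖ := by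
  have h1 := (Matrix.toEuclideanCLM (𝕜 := ℝ) X).le_opNorm (WithLp.toLp 2 a)
  refine le_trans ?_ h1
  have h2 := EuclideanSpace.norm_eq (Matrix.toEuclideanCLM (𝕜 := ℝ) X (WithLp.toLp 2 a))
  have h3 := PiLp.norm_apply_le (Matrix.toEuclideanCLM (𝕜 := ℝ) X (WithLp.toLp 2 a)) i
  simpa using h3

lemma le_of_forall_pow {u w C : ℝ} (hw : 0 ≤ w)
    (h : ∀ j : ℕ, u ^ j ≤ C * w ^ j) : u ≤ w := by
  by_contra! hc
  rcases hw.eq_or_lt with h0 | h0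
  · have := h 1
    rw [← h0] at this hc
    simp at this; linarith
  · have h2 : Tendsto (fun n : ℕ => (u / w) ^ n) atTop atTop :=
      tendsto_pow_atTop_atTop_of_one_lt ((one_lt_div h0).2 hc)
    obtain ⟨n, hn⟩ := (h2.eventually_gt_atTop C).exists
    rw [div_pow, lt_div_iff₀ (by positivity)] at hn
    linarith [h n]

lemma eig_le {d : ℕ} (Y : Matrix (Fin d) (Fin d) ℝ) (z : ℂ)
    (hz : z ∈ (Y.map (algebraMap ℝ ℂ)).charpoly.roots) : ‖z‖ ≤ specRad Y := by
  have hz' : z ∈ spectrum ℂ (Y.map (algebraMap ℝ ℂ)) :=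
    Matrix.mem_spectrum_of_isRoot_charpoly (Polynomial.isRoot_of_mem_roots hz)
  rw [← Matrix.spectrum_toLin', ← Module.End.hasEigenvalue_iff_mem_spectrum] at hz'
  obtain ⟨v, hv⟩ := hz'.exists_hasEigenvector
  have hv0 := hv.2
  have hpow : ∀ n : ℕ, ((Y ^ n).map (algebraMap ℝ ℂ)).mulVec v = z ^ n • v := by
    intro n
    have e : ∀ n : ℕ, (Y ^ n).map (algebraMap ℝ ℂ) = (Y.map (algebraMap ℝ ℂ)) ^ n := fun n =>
      Matrix.map_pow Y (algebraMap ℝ ℂ) n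
    rw [e]
    induction n with
    | zero => simp
    | succ n ih =>
      have h1 := hv.apply_eq_smul
      rw [Matrix.toLin'_apply] at h1
      rw [pow_succ, ← Matrix.mulVec_mulVec, h1, Matrix.mulVec_smul, ih, smul_smul, pow_succ, mul_comm]
  obtain ⟨i, hi⟩ := Function.ne_iff.1 hv0
  have hi' : 0 < ‖v i‖ := norm_pos_iff.2 hi
  set a : Fin d → ℝ := fun j => (v j).re
  set b : Fin d → ℝ := fun j => (v j).im
  set C := (‖WithLp.toLp 2 a‖ + ‖WithLp.toLp 2 b‖) / ‖v i‖ with hC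
  have hb : ∀ n : ℕ, ‖z‖ ^ n ≤ C * opNorm (Y ^ n) := by
    intro n
    have h1 := congrFun (hpow n) i
    have h2 : (z ^ n • v) i = z ^ n * v i := rfl
    have hre : ((z ^ n * v i)).re = ((Y ^ n).mulVec a) i := by
      rw [← h2, ← h1]
      simp [Matrix.mulVec, dotProduct, a]
    have him : ((z ^ n * v i)).im = ((Y ^ n).mulVec b) i := by
      rw [← h2, ← h1]
      simp [Matrix.mulVec, dotProduct, b]
    have h3 := Complex.norm_le_abs_re_add_abs_im (z ^ n * v i)
    rw [hre, him, norm_mul, norm_pow] at h3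
    have h4 := abs_mulVec_le (Y ^ n) a i
    have h5 := abs_mulVec_le (Y ^ n) b i
    rw [hC, div_mul_eq_mul_div, le_div_iff₀ hi']
    linarith
  unfold specRad
  refine le_ciInf fun k => ?_
  have h6 : ‖z‖ ^ (k + 1) ≤ opNorm (Y ^ (k + 1)) := by
    refine le_of_forall_pow (C := C) (opNorm_nonneg _) fun j => ?_
    rw [← pow_mul]
    refine (hb _).trans ?_
    rw [pow_mul]
    exact mul_le_mul_of_nonneg_left (opNorm_pow_le _ _) (by positivity)
  have h7 : (‖z‖ ^ (k + 1)) ^ ((1 : ℝ) / (k + 1)) = ‖z‖ := by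
    have := Real.pow_rpow_inv_natCast (norm_nonneg z) (n := k + 1) (by omega)
    rw [one_div]
    exact_mod_cast this
  calc ‖z‖ = (‖z‖ ^ (k + 1)) ^ ((1 : ℝ) / (k + 1)) := h7.symm
    _ ≤ _ := Real.rpow_le_rpow (by positivity) h6 (by positivity)

lemma trace_le {d : ℕ} (Y : Matrix (Fin d) (Fin d) ℝ) : |Y.trace| ≤ d * specRad Y := by
  set Z := Y.map (algebraMap ℝ ℂ) with hZ
  have h1 : Z.trace = ((Y.trace : ℝ) : ℂ) := by
    simp [hZ, Matrix.trace]
  have h2 : |Y.trace| = ‖Z.trace‖ := by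
    rw [h1, Complex.norm_real, Real.norm_eq_abs]
  rw [h2, Matrix.trace_eq_sum_roots_charpoly]
  have h3 : Z.charpoly.roots.card ≤ d := by
    refine (Polynomial.card_roots' _).trans ?_
    simp [Matrix.charpoly_natDegree_eq_dim]
  calc ‖Z.charpoly.roots.sum‖ ≤ (Z.charpoly.roots.map fun z => ‖z‖).sum := norm_multiset_sum_le _
    _ ≤ (Z.charpoly.roots.map fun z => ‖z‖).card • specRad Y := by
        apply Multiset.sum_le_card_nsmul
        intro y hy
        obtain ⟨z, hz, rfl⟩ := Multiset.mem_map.1 hy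
        exact eig_le Y z hz
    _ ≤ d * specRad Y := by
        rw [Multiset.card_map, nsmul_eq_mul]
        exact mul_le_mul_of_nonneg_right (by exact_mod_cast h3) (specRad_nonneg _)

lemma listProd_append {M d : ℕ} (A : Fin M → Matrix (Fin d) (Fin d) ℝ) (w u : List (Fin M)) :
    listProd A (w ++ u) = listProd A u * listProd A w := by
  simp [listProd]

/-- The algebra generated by the tuple. -/
noncomputable def wordAlg {M d : ℕ} (A : Fin M → Matrix (Fin d) (Fin d) ℝ) :
    Subalgebra ℝ (Matrix (Fin d) (Fin d) ℝ) :=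
  (Submodule.span ℝ (Set.range (listProd A))).toSubalgebra
    (Submodule.subset_span ⟨[], by simp [listProd]⟩)
    (by
      intro X Y hX hY
      have h1 := Submodule.mul_mem_mul hX hY
      rw [Submodule.span_mul_span] at h1
      refine Submodule.span_mono ?_ h1
      rintro _ ⟨_, ⟨w, rfl⟩, _, ⟨u, rfl⟩, rfl⟩
      exact ⟨u ++ w, listProd_append A u w⟩)

lemma mem_wordAlg {M d : ℕ} (A : Fin M → Matrix (Fin d) (Fin d) ℝ) (w : List (Fin M)) :
    listProd A w ∈ wordAlg A := Submodule.subset_span ⟨w, rfl⟩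

lemma mem_wordAlg_iff {M d : ℕ} (A : Fin M → Matrix (Fin d) (Fin d) ℝ)
    (X : Matrix (Fin d) (Fin d) ℝ) :
    X ∈ wordAlg A ↔ X ∈ Submodule.span ℝ (Set.range (listProd A)) := Iff.rfl

open Polynomial in
lemma nondeg {M d : ℕ} (A : Fin M → Matrix (Fin d) (Fin d) ℝ) (hA : IsIrredTuple A)
    (X : Matrix (Fin d) (Fin d) ℝ) (hX : X ∈ wordAlg A)
    (h : ∀ Y ∈ wordAlg A, (X * Y).trace = 0) : X = 0 := by
  by_contra hX0
  have hv : ∃ v, X.mulVec v ≠ 0 := by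
    by_contra! hc
    apply hX0
    apply Matrix.toLin'.injective
    refine LinearMap.ext fun v => ?_
    simp [hc]
  obtain ⟨v, hv⟩ := hv
  have hv0 : v ≠ 0 := by rintro rfl; simp at hv
  let ev : Matrix (Fin d) (Fin d) ℝ →ₗ[ℝ] (Fin d → ℝ) :=
    { toFun := fun Y => Y.mulVec (X.mulVec v)
      map_add' := fun Y Z => Matrix.add_mulVec _ _ _
      map_smul' := fun c Y => Matrix.smul_mulVec _ _ _ }
  let U : Submodule ℝ (Fin d → ℝ) := (Subalgebra.toSubmodule (wordAlg A)).map ev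
  have hU : U = ⊤ := by
    by_contra hne
    refine hA ⟨U, ?_, ?_, hne⟩
    · rintro i _ ⟨_, ⟨Y, hY, rfl⟩, rfl⟩
      refine ⟨A i * Y, ?_, ?_⟩
      · have : A i ∈ wordAlg A := by simpa [listProd] using mem_wordAlg A [i]
        exact (wordAlg A).mul_mem this hY
      · simp [ev, Matrix.mul_assoc]
    · intro hb
      have : X.mulVec v ∈ U := ⟨1, (wordAlg A).one_mem, by simp [ev]⟩
      rw [hb] at this
      exact hv (by simpa using this)
  have hvU : v ∈ U := by rw [hU]; trivial
  obtain ⟨Y, hY, hYv⟩ := hvU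
  have hY : Y ∈ wordAlg A := hY
  have hYv : Y.mulVec (X.mulVec v) = v := hYv
  set Z := Y * X with hZ
  have hZm : Z ∈ wordAlg A := (wordAlg A).mul_mem hY hX
  have hZv : Z.mulVec v = v := by rw [hZ, ← Matrix.mulVec_mulVec, hYv]
  obtain ⟨q, hq, hnd⟩ := exists_eq_pow_rootMultiplicity_mul_and_not_dvd Z.charpoly
    Z.charpoly_monic.ne_zero 1
  set a := Z.charpoly.rootMultiplicity 1
  have hcop : IsCoprime ((Polynomial.X - C (1 : ℝ)) ^ a) (Polynomial.X * q) := by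
    apply IsCoprime.pow_left
    apply IsCoprime.mul_right
    · rw [(irreducible_X_sub_C (1 : ℝ)).coprime_iff_not_dvd, dvd_iff_isRoot]
      simp
    · rwa [(irreducible_X_sub_C (1 : ℝ)).coprime_iff_not_dvd]
  obtain ⟨u, w, huw⟩ := hcop
  set e := Polynomial.X * (w * q) with he
  have hidem : IsIdempotentElem (aeval Z e) := by
    have h1 : e * e = e - (u * Polynomial.X * w) * Z.charpoly := by
      rw [hq]
      have : e = 1 - u * (Polynomial.X - C 1) ^ a := by rw [← huw, he]; ring
      calc e * e = e * (1 - u * (Polynomial.X - C 1) ^ a) := by rw [← this]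
        _ = _ := by rw [he]; ring
    unfold IsIdempotentElem
    rw [← map_mul, h1, map_sub, map_mul _ _ Z.charpoly, Matrix.aeval_self_charpoly]
    simp
  have htr : (aeval Z e).trace = 0 := by
    rw [he, map_mul, aeval_X, hZ, Matrix.mul_assoc, Matrix.trace_mul_comm, Matrix.mul_assoc]
    apply h
    refine (wordAlg A).mul_mem ?_ hY
    have h2 := aeval_mem_adjoin_singleton ℝ (p := w * q) Z
    exact (Algebra.adjoin_le (by simpa using hZm)) h2
  have hid' : IsIdempotentElem (Matrix.toLinAlgEquiv' (aeval Z e)) := by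
    unfold IsIdempotentElem at hidem ⊢
    rw [← map_mul, hidem]
  have h0 : Matrix.toLinAlgEquiv' (aeval Z e) = 0 := by
    apply LinearMap.IsIdempotentElem.eq_zero_of_trace_eq_zero hid'
    rw [← htr]
    exact Matrix.trace_toLin'_eq _
  have hev : Module.End.HasEigenvector (Matrix.toLinAlgEquiv' Z) 1 v := by
    refine ⟨Module.End.mem_eigenspace_iff.2 ?_, hv0⟩
    simp [hZv]
  have h3 := Module.End.aeval_apply_of_hasEigenvector (p := e) hev
  have h4 : aeval (Matrix.toLinAlgEquiv' Z) e = Matrix.toLinAlgEquiv' (aeval Z e) :=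
    aeval_algHom_apply (Matrix.toLinAlgEquiv' : Matrix (Fin d) (Fin d) ℝ ≃ₐ[ℝ] _) Z e
  have h5 : e.eval 1 = 1 - (u * (Polynomial.X - C 1) ^ a).eval 1 := by
    have : e = 1 - u * (Polynomial.X - C 1) ^ a := by rw [← huw, he]; ring
    rw [this]; simp
  have ha : a ≠ 0 := by
    have : 0 < a := by
      rw [rootMultiplicity_pos Z.charpoly_monic.ne_zero, ← Matrix.mem_spectrum_iff_isRoot_charpoly,
        ← Matrix.spectrum_toLin', ← Module.End.hasEigenvalue_iff_mem_spectrum]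
      exact Module.End.hasEigenvalue_of_hasEigenvector hev
    omega
  rw [h4, h0, h5] at h3
  simp [ha] at h3
  exact hv0 h3.symm

lemma norm_le_traces {M d : ℕ} (A : Fin M → Matrix (Fin d) (Fin d) ℝ) (hA : IsIrredTuple A) :
    ∃ (F : Finset (List (Fin M))) (K : ℝ), 0 ≤ K ∧ ∀ u, opNorm (listProd A u) ≤
      K * ∑ w ∈ F, |(listProd A u * listProd A w).trace| := by
  classical
  obtain ⟨b, hb, hspan, hli⟩ := exists_linearIndependent ℝ (Set.range (listProd A))
  have hbf : b.Finite := hli.setFinite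
  have hb' : ∀ Y ∈ b, ∃ w, listProd A w = Y := fun Y hY => hb hY
  choose! g hg using hb'
  let F : Finset (List (Fin M)) := hbf.toFinset.image g
  let Φ : wordAlg A →ₗ[ℝ] (F → ℝ) := LinearMap.pi fun w =>
    (Matrix.traceLinearMap (Fin d) ℝ ℝ) ∘ₗ (LinearMap.mulRight ℝ (listProd A w)) ∘ₗ
      (wordAlg A).val.toLinearMap
  have hΦ : ∀ X w, Φ X w = ((X : Matrix (Fin d) (Fin d) ℝ) * listProd A w).trace := fun _ _ => rfl
  have hker : LinearMap.ker Φ = ⊥ := by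
    rw [LinearMap.ker_eq_bot']
    intro X hX
    apply Subtype.ext
    refine nondeg A hA X X.2 ?_
    intro Y hY
    rw [mem_wordAlg_iff, ← hspan] at hY
    induction hY using Submodule.span_induction with
    | mem Y hY =>
      have := congrFun hX ⟨g Y, Finset.mem_image_of_mem g (hbf.mem_toFinset.2 hY)⟩
      rw [hΦ] at this
      simpa [hg Y hY] using this
    | zero => simp
    | add Y Z _ _ h1 h2 => rw [mul_add, Matrix.trace_add, h1, h2, add_zero]
    | smul c Y _ h1 => rw [mul_smul_comm, Matrix.trace_smul, h1, smul_zero]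
  obtain ⟨Ψ, hΨ⟩ := LinearMap.exists_leftInverse_of_injective Φ hker
  let Θ : (F → ℝ) →L[ℝ] (EuclideanSpace ℝ (Fin d) →L[ℝ] EuclideanSpace ℝ (Fin d)) :=
    LinearMap.toContinuousLinearMap
      ((Matrix.toEuclideanCLM (n := Fin d) (𝕜 := ℝ)).toAlgEquiv.toLinearMap ∘ₗ
        (wordAlg A).val.toLinearMap ∘ₗ Ψ)
  refine ⟨F, ‖Θ‖, norm_nonneg Θ, fun u => ?_⟩
  set X : wordAlg A := ⟨listProd A u, mem_wordAlg A u⟩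
  have h1 : Ψ (Φ X) = X := LinearMap.congr_fun hΨ X
  have h2 : opNorm (listProd A u) = ‖Θ (Φ X)‖ := by
    change _ = ‖Matrix.toEuclideanCLM (n := Fin d) (𝕜 := ℝ) (Ψ (Φ X) : wordAlg A)‖
    rw [h1]; rfl
  rw [h2]
  refine (Θ.le_opNorm _).trans (mul_le_mul_of_nonneg_left ?_ (norm_nonneg Θ))
  rw [pi_norm_le_iff_of_nonneg (Finset.sum_nonneg fun _ _ => abs_nonneg _)]
  intro w
  rw [hΦ, Real.norm_eq_abs]
  exact Finset.single_le_sum (f := fun w => |(listProd A u * listProd A w).trace|)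
    (fun _ _ => abs_nonneg _) w.2

lemma growth_compare {M d₁ d₂ : ℕ} (A : Fin M → Matrix (Fin d₁) (Fin d₁) ℝ)
    (B : Fin M → Matrix (Fin d₂) (Fin d₂) ℝ) (hA : IsIrredTuple A) (s t p : ℝ) (hs : 0 < s)
    (ht : 0 < t)
    (h : ∀ w : List (Fin M), w ≠ [] →
      specRad (listProd A w) ^ s ≤ Real.exp (w.length * p) * specRad (listProd B w) ^ t) :
    ∃ C : ℝ, 0 < C ∧ ∀ u : List (Fin M), u ≠ [] → opNorm (listProd A u) ≤
      C * (Real.exp (u.length * p) * opNorm (listProd B u) ^ t) ^ (1 / s) := by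
  obtain ⟨F, K, hK, hF⟩ := norm_le_traces A hA
  let D : List (Fin M) → ℝ := fun w => (Real.exp (w.length * p) * opNorm (listProd B w) ^ t) ^ (1 / s)
  have hD0 : ∀ w, 0 ≤ D w := fun w => by
    have := opNorm_nonneg (listProd B w)
    positivity
  refine ⟨K * ∑ w ∈ F, d₁ * D w + 1, ?_, fun u hu => ?_⟩
  · have : 0 ≤ ∑ w ∈ F, d₁ * D w := Finset.sum_nonneg fun w _ => mul_nonneg (by positivity) (hD0 w)
    positivity
  have key : ∀ w, specRad (listProd A u * listProd A w) ≤ D w * D u := by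
    intro w
    rw [← listProd_append]
    have hne : w ++ u ≠ [] := by simp [hu]
    have h1 := h _ hne
    have hr := specRad_nonneg (listProd A (w ++ u))
    have hbu := opNorm_nonneg (listProd B u)
    have hbw := opNorm_nonneg (listProd B w)
    have h2 : specRad (listProd B (w ++ u)) ^ t ≤
        opNorm (listProd B w) ^ t * opNorm (listProd B u) ^ t := by
      rw [← Real.mul_rpow hbw hbu]
      refine Real.rpow_le_rpow (specRad_nonneg _) ?_ ht.le
      refine (specRad_le _).trans ?_
      rw [listProd_append, mul_comm (opNorm _)]
      exact opNorm_mul_le _ _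
    have h3 : specRad (listProd A (w ++ u)) ^ s ≤
        (Real.exp (w.length * p) * opNorm (listProd B w) ^ t) *
        (Real.exp (u.length * p) * opNorm (listProd B u) ^ t) := by
      refine h1.trans ((mul_le_mul_of_nonneg_left h2 (by positivity)).trans (le_of_eq ?_))
      rw [List.length_append]
      push_cast
      rw [add_mul, Real.exp_add]; ring
    have h4 := Real.rpow_le_rpow (by positivity) h3 (show 0 ≤ 1 / s by positivity)
    rw [← Real.rpow_mul hr, mul_one_div_cancel hs.ne', Real.rpow_one,
      Real.mul_rpow (by positivity) (by positivity)] at h4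
    exact h4
  calc opNorm (listProd A u) ≤ K * ∑ w ∈ F, |(listProd A u * listProd A w).trace| := hF u
    _ ≤ K * ∑ w ∈ F, d₁ * D w * D u := by
      refine mul_le_mul_of_nonneg_left (Finset.sum_le_sum fun w _ => ?_) hK
      refine (trace_le _).trans ?_
      rw [mul_assoc]
      exact mul_le_mul_of_nonneg_left (key w) (by positivity)
    _ = (K * ∑ w ∈ F, d₁ * D w) * D u := by rw [← Finset.sum_mul, mul_assoc]
    _ ≤ _ := mul_le_mul_of_nonneg_right (by linarith) (hD0 u)

end Alg

section Fin

lemma wordProd_eq {M d n : ℕ} (A : Fin M → Matrix (Fin d) (Fin d) ℝ) (x : Fin n → Fin M) :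
    wordProd A x = listProd A (List.ofFn x) := by
  simp [wordProd, listProd, List.map_ofFn, Function.comp_def]

lemma ofFn_eq_range {M : ℕ} (x : ℕ → Fin M) (n : ℕ) :
    List.ofFn (fun i : Fin n => x (i : ℕ)) = (List.range n).map x := by
  apply List.ext_getElem <;> simp

lemma shift_iter {M : ℕ} (x : ℕ → Fin M) (m k : ℕ) : (shift^[m] x) k = x (m + k) := by
  induction m generalizing x with
  | zero => simp
  | succ m ih =>
    rw [Function.iterate_succ_apply, ih]
    simp only [shift]
    congr 1; omega

lemma exists_growth {M d : ℕ} (A : Fin M → Matrix (Fin d) (Fin d) ℝ) (ν : Measure (ℕ → Fin M))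
    [IsProbabilityMeasure ν] (hE : Ergodic (shift (M := M)) ν) :
    ∀ᵐ x ∂ν, ∃ l : ℝ, 0 ≤ l ∧ Tendsto (fun n : ℕ =>
      opNorm (wordProd A (fun i : Fin (n + 1) => x (i : ℕ))) ^ ((1 : ℝ) / (n + 1)))
      atTop (𝓝 l) := by
  set K : ℝ := 1 + ∑ i, opNorm (A i) with hK
  have hK0 : 0 < K := by
    have : 0 ≤ ∑ i, opNorm (A i) := Finset.sum_nonneg fun i _ => opNorm_nonneg _
    linarith
  have hAK : ∀ i, opNorm (A i) ≤ K := fun i => by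
    have := Finset.single_le_sum (f := fun i => opNorm (A i)) (fun i _ => opNorm_nonneg _)
      (Finset.mem_univ i)
    linarith
  let c : ℕ → (ℕ → Fin M) → ℝ := fun n x => opNorm (wordProd A (fun i : Fin n => x (i : ℕ)))
  have hc : ∀ n x, c n x = opNorm (listProd A ((List.range n).map x)) := by
    intro n x
    simp only [c]
    rw [wordProd_eq, ofFn_eq_range]
  have hc0 : ∀ n x, 0 ≤ c n x := fun n x => opNorm_nonneg _
  have hcsub : ∀ m n x, c (m + n) x ≤ c m x * c n (shift^[m] x) := by
    intro m n x
    rw [hc, hc, hc, List.range_add, List.map_append, listProd_append, mul_comm (opNorm _)]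
    have : List.map (shift^[m] x) (List.range n) = List.map x (List.map (fun k => m + k) (List.range n)) := by
      rw [List.map_map]
      exact List.map_congr_left fun k _ => shift_iter x m k
    rw [this]
    exact opNorm_mul_le _ _
  have hcK : ∀ n x, c n x ≤ K ^ n := by
    intro n
    induction n with
    | zero => intro x; rw [hc]; simpa [listProd] using opNorm_one_le
    | succ n ih =>
      intro x
      refine (hcsub n 1 x).trans ?_
      rw [pow_succ]
      refine mul_le_mul (ih x) ?_ (hc0 _ _) (by positivity)
      rw [hc]
      simpa [listProd] using hAK _
  have hcm : ∀ n, Measurable (c n) := by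
    intro n
    have h1 : Measurable fun x : ℕ → Fin M => (fun i : Fin n => x (i : ℕ)) :=
      measurable_pi_lambda _ fun i => measurable_pi_apply _
    have h2 : Measurable fun y : Fin n → Fin M => opNorm (wordProd A y) := measurable_of_finite _
    exact h2.comp h1
  obtain ⟨L, hL0, hL⟩ := kingman hE (fun n x => c n x / K ^ n) (fun n => (hcm n).div_const _)
    (fun n x => div_nonneg (hc0 n x) (by positivity))
    (fun n x => (div_le_one (by positivity)).2 (hcK n x))
    (fun m n x => by
      rw [div_mul_div_comm, ← pow_add]
      exact div_le_div_of_nonneg_right (hcsub m n x) (by positivity))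
  filter_upwards [hL] with x hx
  refine ⟨K * L, by positivity, ?_⟩
  have h1 := ((tendsto_add_atTop_iff_nat 1).2 hx).const_mul K
  refine h1.congr fun n => ?_
  rw [Real.div_rpow (hc0 _ _) (by positivity), one_div, Real.pow_rpow_inv_natCast hK0.le (by omega),
    mul_div_cancel₀ _ hK0.ne']
  push_cast
  rw [one_div]

lemma limit_compare {M d₁ d₂ : ℕ} (A : Fin M → Matrix (Fin d₁) (Fin d₁) ℝ)
    (B : Fin M → Matrix (Fin d₂) (Fin d₂) ℝ) (s t p C : ℝ) (hs : 0 < s)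
    (ht : 0 < t) (hC : 0 < C)
    (h : ∀ u : List (Fin M), u ≠ [] → opNorm (listProd A u) ≤
      C * (Real.exp (u.length * p) * opNorm (listProd B u) ^ t) ^ (1 / s))
    (x : ℕ → Fin M) (lA lB : ℝ) (hA0 : 0 ≤ lA) (hB0 : 0 ≤ lB)
    (hA : Tendsto (fun n : ℕ =>
      opNorm (wordProd A (fun i : Fin (n + 1) => x (i : ℕ))) ^ ((1 : ℝ) / (n + 1)))
      atTop (𝓝 lA))
    (hB : Tendsto (fun n : ℕ =>
      opNorm (wordProd B (fun i : Fin (n + 1) => x (i : ℕ))) ^ ((1 : ℝ) / (n + 1)))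
      atTop (𝓝 lB)) :
    lA ^ s ≤ Real.exp p * lB ^ t := by
  have hCt : Tendsto (fun n : ℕ => C ^ ((1 : ℝ) / (n + 1))) atTop (𝓝 1) := by
    have h1 : Continuous fun y : ℝ => C ^ y :=
      Continuous.rpow (by fun_prop) (by fun_prop) (fun _ => Or.inl hC.ne')
    have h2 := (h1.tendsto 0).comp tendsto_one_div_add_atTop_nhds_zero_nat
    simpa [Function.comp_def] using h2
  have hR : Tendsto (fun n : ℕ => C ^ ((1 : ℝ) / (n + 1)) * (Real.exp p *
      (opNorm (wordProd B (fun i : Fin (n + 1) => x (i : ℕ))) ^ ((1 : ℝ) / (n + 1))) ^ t) ^ (1 / s))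
      atTop (𝓝 (1 * (Real.exp p * lB ^ t) ^ (1 / s))) := by
    refine hCt.mul ?_
    refine Tendsto.rpow_const (Tendsto.const_mul _ (Tendsto.rpow_const hB (Or.inr ht.le))) ?_
    right; positivity
  have hle := le_of_tendsto_of_tendsto' hA hR (fun n => by
    have h1 := h (List.ofFn (fun i : Fin (n + 1) => x (i : ℕ))) (by simp)
    rw [← wordProd_eq, ← wordProd_eq, List.length_ofFn] at h1
    set a := opNorm (wordProd A (fun i : Fin (n + 1) => x (i : ℕ)))
    set b := opNorm (wordProd B (fun i : Fin (n + 1) => x (i : ℕ)))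
    have ha : 0 ≤ a := opNorm_nonneg _
    have hb : 0 ≤ b := opNorm_nonneg _
    have hn : (0 : ℝ) < n + 1 := by positivity
    have h2 := Real.rpow_le_rpow ha h1 (show (0 : ℝ) ≤ 1 / (n + 1) by positivity)
    refine h2.trans (le_of_eq ?_)
    rw [Real.mul_rpow hC.le (by positivity)]
    congr 1
    rw [← Real.rpow_mul (by positivity), mul_comm (1 / s), Real.rpow_mul (by positivity)]
    congr 1
    rw [Real.mul_rpow (by positivity) (by positivity), ← Real.exp_mul, ← Real.rpow_mul hb,
      ← Real.rpow_mul hb, mul_comm t]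
    congr 2
    push_cast
    field_simp)
  rw [one_mul] at hle
  have h3 := Real.rpow_le_rpow hA0 hle hs.le
  rwa [← Real.rpow_mul (by positivity), one_div, inv_mul_cancel₀ hs.ne', Real.rpow_one] at h3

end Fin

/-- equality of normalised spectral radii implies the almost sure exponential
growth rates of the two cocycles are related by `ℓ_A(x)^s = e^{P(A,s) - P(B,t)} ℓ_B(x)^t`
(Theorem 4.1, (iii) ⟹ (iv)). -/
theorem stmt_11 {M d₁ d₂ : ℕ} (hM : 2 ≤ M)
    (A : Fin M → Matrix (Fin d₁) (Fin d₁) ℝ) (B : Fin M → Matrix (Fin d₂) (Fin d₂) ℝ)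
    (hA : IsIrredTuple A) (hB : IsIrredTuple B)
    (s t : ℝ) (hs : 0 < s) (ht : 0 < t)
    (hPA : ⊥ < pressure A s) (hPB : ⊥ < pressure B t)
    (h : ∀ n : ℕ, 0 < n → ∀ x : Fin n → Fin M,
      Real.exp (-(n : ℝ) * (pressure A s).toReal) * specRad (wordProd A x) ^ s =
        Real.exp (-(n : ℝ) * (pressure B t).toReal) * specRad (wordProd B x) ^ t) :
    ∀ ν : Measure (ℕ → Fin M), IsProbabilityMeasure ν →
      MeasurePreserving (shift (M := M)) ν ν → Ergodic (shift (M := M)) ν →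
      ∀ᵐ x ∂ν, ∃ lA lB : ℝ, 0 ≤ lA ∧ 0 ≤ lB ∧
        Filter.Tendsto
          (fun n : ℕ => opNorm (wordProd A (fun i : Fin (n + 1) => x (i : ℕ))) ^ ((1 : ℝ) / (n + 1)))
          Filter.atTop (nhds lA) ∧
        Filter.Tendsto
          (fun n : ℕ => opNorm (wordProd B (fun i : Fin (n + 1) => x (i : ℕ))) ^ ((1 : ℝ) / (n + 1)))
          Filter.atTop (nhds lB) ∧
        lA ^ s = Real.exp ((pressure A s).toReal - (pressure B t).toReal) * lB ^ t := by
  intro ν hν _ hE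
  set PA := (pressure A s).toReal
  set PB := (pressure B t).toReal
  have hlist : ∀ w : List (Fin M), w ≠ [] →
      Real.exp (-(w.length : ℝ) * PA) * specRad (listProd A w) ^ s =
        Real.exp (-(w.length : ℝ) * PB) * specRad (listProd B w) ^ t := by
    intro w hw
    have := h w.length (List.length_pos_iff.2 hw) w.get
    have e : ∀ {d : ℕ} (A : Fin M → Matrix (Fin d) (Fin d) ℝ), wordProd A w.get = listProd A w := by
      intro d A
      rw [wordProd_eq, List.ofFn_get]
    rwa [e A, e B] at this
  obtain ⟨C, hC, hCA⟩ := growth_compare A B hA s t (PA - PB) hs ht (fun w hw => by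
    have h1 := hlist w hw
    refine le_of_eq ?_
    have h2 : Real.exp (w.length * (PA - PB)) =
        Real.exp (w.length * PA) * Real.exp (-(w.length : ℝ) * PB) := by
      rw [← Real.exp_add]; ring_nf
    rw [h2, mul_assoc, ← h1, ← mul_assoc, ← Real.exp_add]
    simp)
  obtain ⟨D, hD, hDB⟩ := growth_compare B A hB t s (PB - PA) ht hs (fun w hw => by
    have h1 := hlist w hw
    refine le_of_eq ?_
    have h2 : Real.exp (w.length * (PB - PA)) =
        Real.exp (w.length * PB) * Real.exp (-(w.length : ℝ) * PA) := by
      rw [← Real.exp_add]; ring_nf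
    rw [h2, mul_assoc, h1, ← mul_assoc, ← Real.exp_add]
    simp)
  filter_upwards [exists_growth A ν hE, exists_growth B ν hE] with x ⟨lA, hlA0, hlA⟩ ⟨lB, hlB0, hlB⟩
  refine ⟨lA, lB, hlA0, hlB0, hlA, hlB, ?_⟩
  have h1 := limit_compare A B s t (PA - PB) C hs ht hC hCA x lA lB hlA0 hlB0 hlA hlB
  have h2 := limit_compare B A t s (PB - PA) D ht hs hD hDB x lB lA hlB0 hlA0 hlB hlA
  refine le_antisymm h1 ?_
  refine (mul_le_mul_of_nonneg_left h2 (Real.exp_pos _).le).trans (le_of_eq ?_)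
  rw [← mul_assoc, ← Real.exp_add]
  simp
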